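/- In sp(2n,ℝ), the closure of the set 𝒟 = {X : the centralizer {S ∈ Sp(2n,ℝ) : SX = XS} is compact} of strongly stable elements equals the closure of the set of stable elements {X : ∃ S ∈ Sp(2n,ℝ), (S⁻¹XS)Ω = Ω(S⁻¹XS)}. -/

import Mathlib

open Matrix

/-- The standard symplectic form matrix `Ω = [[0, Iₙ], [-Iₙ, 0]]` on `ℝ²ⁿ`
(coordinates indexed by `Fin n ⊕ Fin n`). -/
noncomputable def Omega (n : ℕ) : Matrix (Fin n ⊕ Fin n) (Fin n ⊕ Fin n) ℝ :=
  Matrix.fromBlocks 0 1 (-1) 0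

/-- The real symplectic group `Sp(2n, ℝ) = {S : Sᵀ Ω S = Ω}`. -/
noncomputable def Sp (n : ℕ) : Set (Matrix (Fin n ⊕ Fin n) (Fin n ⊕ Fin n) ℝ) :=
  {S | Sᵀ * Omega n * S = Omega n}

/-- The symplectic Lie algebra `sp(2n, ℝ) = {X : Xᵀ Ω + Ω X = 0}`. -/
noncomputable def sp (n : ℕ) : Set (Matrix (Fin n ⊕ Fin n) (Fin n ⊕ Fin n) ℝ) :=
  {X | Xᵀ * Omega n + Omega n * X = 0}

section Sqrt
open scoped MatrixOrder
variable {m : Type*} [Fintype m] [DecidableEq m]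

theorem Matrix.PosDef.exists_sqrt {P : Matrix m m ℝ} (hP : P.PosDef) :
    ∃ R : Matrix m m ℝ, R.PosDef ∧ R * R = P ∧ ∀ A, Commute P A → Commute R A := by
  have h0 : 0 ≤ P := hP.posSemidef.nonneg
  refine ⟨CFC.sqrt P, ?_, CFC.sqrt_mul_sqrt_self P h0, fun A hA ↦ ?_⟩
  · exact isStrictlyPositive_iff_posDef.mp
      (IsStrictlyPositive.sqrt P (isStrictlyPositive_iff_posDef.mpr hP))
  · rw [CFC.sqrt_eq_cfc]
    exact hA.cfc_nnreal _

theorem Matrix.PosDef.eq_of_mul_self_eq {R T : Matrix m m ℝ} (hR : R.PosDef) (hT : T.PosDef)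
    (h : R * R = T * T) : R = T := by
  rw [← CFC.sqrt_mul_self R hR.posSemidef.nonneg, h, CFC.sqrt_mul_self T hT.posSemidef.nonneg]

end Sqrt

section Polar
variable {m : Type*} [Fintype m] [DecidableEq m]

theorem Matrix.PosDef.transpose_eq {ι : Type*} {P : Matrix ι ι ℝ} (hP : P.PosDef) : Pᵀ = P := by
  simpa [conjTranspose_eq_transpose_of_trivial] using hP.isHermitian.eq

theorem Matrix.PosDef.transpose_mul_mul {P A : Matrix m m ℝ} (hP : P.PosDef) (hA : IsUnit A) :
    (Aᵀ * P * A).PosDef := by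
  have := (Matrix.IsUnit.posDef_star_left_conjugate_iff hA).2 hP
  simpa [star_eq_conjTranspose, conjTranspose_eq_transpose_of_trivial] using this

/-- The positive square root of a positive definite symplectic matrix is symplectic. -/
theorem exists_symplectic_sqrt {W Q : Matrix m m ℝ} (hWt : Wᵀ = -W) (hW : W * W = -1)
    (hQ : Q.PosDef) (hQW : Q * W * Q = W) :
    ∃ R : Matrix m m ℝ, R.PosDef ∧ R * R = Q ∧ R * W * R = W := by
  obtain ⟨R, hR, hRQ, -⟩ := hQ.exists_sqrt
  refine ⟨R, hR, hRQ, ?_⟩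
  have hRd : IsUnit R.det := (isUnit_iff_isUnit_det _).1 hR.isUnit
  have hWu : IsUnit W := by
    refine ⟨⟨W, -W, ?_, ?_⟩, rfl⟩ <;> simp [hW]
  have hT : (Wᵀ * R⁻¹ * W).PosDef := hR.inv.transpose_mul_mul hWu
  have hinv : R⁻¹ * R⁻¹ = -(W * Q * W) := by
    rw [← Matrix.mul_inv_rev, hRQ]
    apply inv_eq_left_inv
    rw [neg_mul, mul_assoc W, mul_assoc W, hQW, hW, neg_neg]
  have hsq : R * R = (Wᵀ * R⁻¹ * W) * (Wᵀ * R⁻¹ * W) := by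
    calc R * R = (W * W) * Q * (W * W) := by simp [hW, hRQ]
      _ = W * (W * Q * W) * W := by simp only [mul_assoc]
      _ = - (W * (R⁻¹ * R⁻¹) * W) := by rw [hinv]; simp
      _ = W * R⁻¹ * (W * W) * R⁻¹ * W := by rw [hW]; simp [mul_assoc]
      _ = _ := by rw [hWt]; simp [mul_assoc]
  have heq := hR.eq_of_mul_self_eq hT hsq
  have h1 : W * R = R⁻¹ * W := by
    calc W * R = W * (Wᵀ * R⁻¹ * W) := by rw [← heq]
      _ = -(W * W) * R⁻¹ * W := by rw [hWt]; simp [mul_assoc]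
      _ = R⁻¹ * W := by rw [hW]; simp
  rw [mul_assoc, h1, ← mul_assoc, mul_nonsing_inv _ hRd, one_mul]

/-- A positive definite form invariant under an element `X` of the Lie algebra of the symplectic
form `W` can be replaced by one which is moreover symplectic. -/
theorem exists_symplectic_invariant_form {W P X : Matrix m m ℝ} (hWt : Wᵀ = -W) (hW : W * W = -1)
    (hP : P.PosDef) (hPX : Xᵀ * P + P * X = 0) (hWX : Xᵀ * W + W * X = 0) :
    ∃ Q : Matrix m m ℝ, Q.PosDef ∧ Q * W * Q = W ∧ Xᵀ * Q + Q * X = 0 := by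
  obtain ⟨R, hR, hRP, -⟩ := hP.exists_sqrt
  have hRd : IsUnit R.det := (isUnit_iff_isUnit_det _).1 hR.isUnit
  have hRt := hR.transpose_eq
  have hR1 : R * R⁻¹ = 1 := mul_nonsing_inv _ hRd
  have hR2 : R⁻¹ * R = 1 := nonsing_inv_mul _ hRd
  have hRit : R⁻¹ᵀ = R⁻¹ := by rw [transpose_nonsing_inv, hRt]
  have hWu : IsUnit W := by
    refine ⟨⟨W, -W, ?_, ?_⟩, rfl⟩ <;> simp [hW]
  have hRu : IsUnit R⁻¹ := hR.inv.isUnit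
  set B := R⁻¹ * W * R⁻¹ with hB
  set Y := R * X * R⁻¹ with hY
  have hBt : Bᵀ = -B := by simp [hB, hRit, hWt, mul_assoc]
  have hBu : IsUnit B := (hRu.mul hWu).mul hRu
  have hYt : Yᵀ = -Y := by
    have : R⁻¹ * (Xᵀ * P + P * X) * R⁻¹ = Yᵀ + Y := by
      rw [← hRP, hY, transpose_mul, transpose_mul, hRit, hRt]
      calc _ = R⁻¹ * Xᵀ * R * (R * R⁻¹) + (R⁻¹ * R) * R * X * R⁻¹ := by noncomm_ring
        _ = _ := by rw [hR1, hR2]; noncomm_ring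
    rw [hPX] at this
    rw [eq_neg_iff_add_eq_zero, ← this]; simp
  have hBY : B * Y = Y * B := by
    have : R⁻¹ * (Xᵀ * W + W * X) * R⁻¹ = Yᵀ * B + B * Y := by
      rw [hB, hY, transpose_mul, transpose_mul, hRit, hRt]
      calc _ = R⁻¹ * Xᵀ * 1 * W * R⁻¹ + R⁻¹ * W * 1 * X * R⁻¹ := by noncomm_ring
        _ = R⁻¹ * Xᵀ * (R * R⁻¹) * W * R⁻¹ + R⁻¹ * W * (R⁻¹ * R) * X * R⁻¹ := by rw [hR1, hR2]
        _ = _ := by noncomm_ring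
    rw [hWX, hYt] at this
    have h2 : Y * B = B * Y + (-Y * B + B * Y) * (-1) := by noncomm_ring
    rw [h2, ← this]; simp
  have hBB : (Bᵀ * B).PosDef := by
    simpa using PosDef.one.transpose_mul_mul hBu
  obtain ⟨K, hK, hKB, hKc⟩ := hBB.exists_sqrt
  have hcB : Commute K B := hKc B (by rw [hBt]; exact (Commute.refl B).neg_left.mul_left (.refl B))
  have hcY : Commute K Y := hKc Y (by
    rw [hBt]
    exact (Commute.neg_left hBY).mul_left hBY)
  have hKd : IsUnit K.det := (isUnit_iff_isUnit_det _).1 hK.isUnit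
  have hQ : (R * K * R).PosDef := by
    simpa [hRt] using hK.transpose_mul_mul hR.isUnit
  have hWB : W = R * B * R := by
    calc W = 1 * W * 1 := by simp
      _ = (R * R⁻¹) * W * (R⁻¹ * R) := by rw [hR1, hR2]
      _ = _ := by rw [hB]; noncomm_ring
  have hRX : R * X = Y * R := by rw [hY, mul_assoc, hR2, mul_one]
  have hXR : Xᵀ * R = -(R * Y) := by
    have := congrArg transpose hRX
    rw [transpose_mul, transpose_mul, hYt, hRt] at this
    rw [this]; simp
  refine ⟨R * K * R, hQ, ?_, ?_⟩
  · have hKK : K * K = -(B * B) := by rw [hKB, hBt, neg_mul]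
    have hBC : B * (R * W * R) = -1 := by
      calc B * (R * W * R) = R⁻¹ * W * (R⁻¹ * R) * W * R := by rw [hB]; noncomm_ring
        _ = R⁻¹ * (W * W) * R := by rw [hR2]; noncomm_ring
        _ = -1 := by rw [hW]; simp [hR2]
    have hCB : (R * W * R) * B = -1 := by
      calc (R * W * R) * B = R * W * (R * R⁻¹) * W * R⁻¹ := by rw [hB]; noncomm_ring
        _ = R * (W * W) * R⁻¹ := by rw [hR1]; noncomm_ring
        _ = -1 := by rw [hW]; simp [hR1]
    have hKCK : K * (R * W * R) * K = B := by
      set C := R * W * R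
      calc K * C * K = -(K * C * K * (-1)) := by simp
        _ = -(K * C * (K * B) * C) := by rw [← hBC]; noncomm_ring
        _ = -(K * (C * B) * K * C) := by rw [hcB.eq]; noncomm_ring
        _ = K * K * C := by rw [hCB]; noncomm_ring
        _ = -(B * (B * C)) := by rw [hKK]; noncomm_ring
        _ = B := by rw [hBC]; simp
    calc R * K * R * W * (R * K * R) = R * (K * (R * W * R) * K) * R := by noncomm_ring
      _ = W := by rw [hKCK, ← hWB]
  · calc Xᵀ * (R * K * R) + R * K * R * X = (Xᵀ * R) * K * R + R * K * (R * X) := by noncomm_ring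
      _ = R * (K * Y - Y * K) * R := by rw [hXR, hRX]; noncomm_ring
      _ = 0 := by rw [hcY.eq]; simp

/-- An element of the Lie algebra of the symplectic form `W` which leaves a positive definite form
invariant is symplectically conjugate to a skew-symmetric matrix commuting with `W`. -/
theorem exists_conj_commute_of_invariant_form {W P X : Matrix m m ℝ} (hWt : Wᵀ = -W)
    (hW : W * W = -1) (hP : P.PosDef) (hPX : Xᵀ * P + P * X = 0) (hWX : Xᵀ * W + W * X = 0) :
    ∃ S : Matrix m m ℝ, Sᵀ * W * S = W ∧ (S⁻¹ * X * S) * W = W * (S⁻¹ * X * S) := by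
  obtain ⟨Q, hQ, hQW, hQX⟩ := exists_symplectic_invariant_form hWt hW hP hPX hWX
  obtain ⟨R, hR, hRQ, hRW⟩ := exists_symplectic_sqrt hWt hW hQ hQW
  have hRd : IsUnit R.det := (isUnit_iff_isUnit_det _).1 hR.isUnit
  have hR1 : R * R⁻¹ = 1 := mul_nonsing_inv _ hRd
  have hR2 : R⁻¹ * R = 1 := nonsing_inv_mul _ hRd
  have hRit : R⁻¹ᵀ = R⁻¹ := by rw [transpose_nonsing_inv, hR.transpose_eq]
  have hRiW : R⁻¹ * W * R⁻¹ = W := by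
    calc R⁻¹ * W * R⁻¹ = R⁻¹ * (R * W * R) * R⁻¹ := by rw [hRW]
      _ = (R⁻¹ * R) * W * (R * R⁻¹) := by noncomm_ring
      _ = W := by simp [hR1, hR2]
  refine ⟨R⁻¹, by rw [hRit, hRiW], ?_⟩
  rw [nonsing_inv_nonsing_inv _ hRd]
  have h1 : R⁻¹ * Xᵀ * R + R * X * R⁻¹ = 0 := by
    calc R⁻¹ * Xᵀ * R + R * X * R⁻¹
        = R⁻¹ * Xᵀ * R * 1 + 1 * R * X * R⁻¹ := by simp
      _ = R⁻¹ * Xᵀ * R * (R * R⁻¹) + (R⁻¹ * R) * R * X * R⁻¹ := by rw [hR1, hR2]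
      _ = R⁻¹ * (Xᵀ * (R * R) + (R * R) * X) * R⁻¹ := by noncomm_ring
      _ = 0 := by rw [hRQ, hQX]; simp
  have h2 : R⁻¹ * Xᵀ * R * W + W * (R * X * R⁻¹) = 0 := by
    calc R⁻¹ * Xᵀ * R * W + W * (R * X * R⁻¹)
        = R⁻¹ * Xᵀ * R * (R⁻¹ * W * R⁻¹) + (R⁻¹ * W * R⁻¹) * (R * X * R⁻¹) := by rw [hRiW]
      _ = R⁻¹ * Xᵀ * (R * R⁻¹) * W * R⁻¹ + R⁻¹ * W * (R⁻¹ * R) * X * R⁻¹ := by noncomm_ring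
      _ = R⁻¹ * (Xᵀ * W + W * X) * R⁻¹ := by rw [hR1, hR2]; noncomm_ring
      _ = 0 := by rw [hWX]; simp
  calc R * X * R⁻¹ * W = (R⁻¹ * Xᵀ * R + R * X * R⁻¹) * W
        - (R⁻¹ * Xᵀ * R * W + W * (R * X * R⁻¹)) + W * (R * X * R⁻¹) := by noncomm_ring
    _ = W * (R * X * R⁻¹) := by rw [h1, h2]; simp

end Polar
section Average
open scoped Matrix.Norms.Operator
open NormedSpace Filter Topology
variable {m : Type*} [Fintype m] [DecidableEq m]

theorem LinearMap.intervalIntegral_comp_comm {V E : Type*} [NormedAddCommGroup V] [NormedSpace ℝ V]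
    [FiniteDimensional ℝ V] [NormedAddCommGroup E] [NormedSpace ℝ E] [CompleteSpace E]
    (L : V →ₗ[ℝ] E) {F : ℝ → V} (hF : Continuous F) (a b : ℝ) :
    L (∫ t in a..b, F t) = ∫ t in a..b, L (F t) :=
  have : CompleteSpace V := FiniteDimensional.complete ℝ V
  ((LinearMap.toContinuousLinearMap L).intervalIntegral_comp_comm
    (hF.intervalIntegrable _ _)).symm

/-- If the one-parameter group of `X` stays in a compact set of invertible matrices, then `X` leaves
some positive definite form invariant. -/
theorem exists_invariant_form_of_exp_mem_compact {X : Matrix m m ℝ} {C : Set (Matrix m m ℝ)}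
    (hC : IsCompact C) (hCu : ∀ S ∈ C, IsUnit S) (hX : ∀ t : ℝ, exp (t • X) ∈ C) :
    ∃ P : Matrix m m ℝ, P.PosDef ∧ Xᵀ * P + P * X = 0 := by
  let F : ℝ → Matrix m m ℝ := fun t ↦ (exp (t • X))ᵀ * exp (t • X)
  have hF' (t : ℝ) : HasDerivAt F (Xᵀ * F t + F t * X) t := by
    have h1 := hasDerivAt_exp_smul_const X t
    have h2 := hasDerivAt_exp_smul_const' Xᵀ t
    have h3 : F = fun t ↦ exp (t • Xᵀ) * exp (t • X) := by
      funext t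
      rw [← transpose_smul, Matrix.exp_transpose]
    rw [h3]
    refine (h2.mul h1).congr_deriv ?_
    simp only [mul_assoc]
    rfl
  have hFc : Continuous F := continuous_iff_continuousAt.2 fun t ↦ (hF' t).continuousAt
  obtain ⟨M, hM⟩ : ∃ M, ∀ t, ‖F t‖ ≤ M := by
    have : IsCompact ((fun S : Matrix m m ℝ ↦ Sᵀ * S) '' C) := hC.image (by fun_prop)
    obtain ⟨M, hM⟩ := this.isBounded.exists_norm_le
    exact ⟨M, fun t ↦ hM _ ⟨_, hX t, rfl⟩⟩
  let A : ℕ → Matrix m m ℝ := fun k ↦ ((k : ℝ) + 1)⁻¹ • ∫ t in (0 : ℝ)..((k : ℝ) + 1), F t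
  have hA (k : ℕ) : A k ∈ Metric.closedBall (0 : Matrix m m ℝ) M := by
    have := intervalIntegral.norm_integral_le_of_norm_le_const (a := 0) (b := (k : ℝ) + 1)
      (f := F) (C := M) fun t _ ↦ hM t
    have hk : (0 : ℝ) < k + 1 := by positivity
    rw [mem_closedBall_zero_iff, norm_smul, norm_inv, Real.norm_of_nonneg hk.le]
    rw [inv_mul_le_iff₀ hk]
    rw [sub_zero, abs_of_pos hk] at this
    linarith
  have hAX (k : ℕ) : Xᵀ * A k + A k * X = ((k : ℝ) + 1)⁻¹ • (F (k + 1) - F 0) := by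
    let L : Matrix m m ℝ →ₗ[ℝ] Matrix m m ℝ := LinearMap.mulLeft ℝ Xᵀ + LinearMap.mulRight ℝ X
    have hL (Z) : L Z = Xᵀ * Z + Z * X := rfl
    rw [← hL, map_smul, L.intervalIntegral_comp_comm hFc]
    congr 1
    exact intervalIntegral.integral_eq_sub_of_hasDerivAt (fun t _ ↦ hF' t)
      ((L.continuous_of_finiteDimensional.comp hFc).intervalIntegrable _ _)
  have hq (v : m → ℝ) (hv : v ≠ 0) : ∃ δ > 0, ∀ k, δ ≤ v ⬝ᵥ (A k *ᵥ v) := by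
    obtain ⟨S, hS, hmin⟩ := hC.exists_isMinOn ⟨_, hX 0⟩
      (f := fun S : Matrix m m ℝ ↦ v ⬝ᵥ ((Sᵀ * S) *ᵥ v)) (by fun_prop)
    refine ⟨v ⬝ᵥ ((Sᵀ * S) *ᵥ v), ?_, fun k ↦ ?_⟩
    · have : S *ᵥ v ≠ 0 := fun h ↦ hv
        (mulVec_injective_of_isUnit (hCu S hS) (by simpa using h))
      rw [← mulVec_mulVec, dotProduct_mulVec, vecMul_transpose]
      simpa using dotProduct_star_self_pos_iff.2 this
    · let L : Matrix m m ℝ →ₗ[ℝ] ℝ :=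
        { toFun := fun Z ↦ v ⬝ᵥ (Z *ᵥ v)
          map_add' := fun Z Z' ↦ by simp [add_mulVec]
          map_smul' := fun c Z ↦ by simp [smul_mulVec] }
      have hL (Z) : L Z = v ⬝ᵥ (Z *ᵥ v) := rfl
      have hk : (0 : ℝ) < k + 1 := by positivity
      rw [← hL (A k), map_smul, L.intervalIntegral_comp_comm hFc, smul_eq_mul, le_inv_mul_iff₀ hk]
      calc _ = ∫ _ in (0 : ℝ)..((k : ℝ) + 1), v ⬝ᵥ ((Sᵀ * S) *ᵥ v) := by simp
        _ ≤ _ := intervalIntegral.integral_mono_on hk.le (by simp)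
          ((L.continuous_of_finiteDimensional.comp hFc).intervalIntegrable _ _)
          fun t _ ↦ hmin (hX t)
  obtain ⟨P, -, φ, hφ, hlim⟩ := tendsto_subseq_of_bounded Metric.isBounded_closedBall hA
  refine ⟨P, ?_, ?_⟩
  · refine .of_dotProduct_mulVec_pos ?_ fun v hv ↦ ?_
    · have hs (k : ℕ) : (A k)ᵀ = A k := by
        let L : Matrix m m ℝ →ₗ[ℝ] Matrix m m ℝ := (transposeLinearEquiv m m ℝ ℝ).toLinearMap
        have hL (Z) : L Z = Zᵀ := rfl
        rw [← hL, map_smul, L.intervalIntegral_comp_comm hFc]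
        have hFs (t : ℝ) : (F t)ᵀ = F t := by simp [F]
        simp only [hL, hFs]
        rfl
      have : Tendsto (fun k ↦ (A (φ k))ᵀ) atTop (𝓝 Pᵀ) :=
        (Continuous.matrix_transpose continuous_id).continuousAt.tendsto.comp hlim
      simp only [hs] at this
      rw [IsHermitian, conjTranspose_eq_transpose_of_trivial]
      exact tendsto_nhds_unique this hlim
    · obtain ⟨δ, hδ, h⟩ := hq v hv
      have : Tendsto (fun k ↦ v ⬝ᵥ (A (φ k) *ᵥ v)) atTop (𝓝 (v ⬝ᵥ (P *ᵥ v))) :=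
        ((by fun_prop : Continuous fun Z : Matrix m m ℝ ↦ v ⬝ᵥ (Z *ᵥ v)).tendsto P).comp hlim
      simpa using hδ.trans_le (ge_of_tendsto' this fun k ↦ h _)
  · have h1 : Tendsto (fun k ↦ Xᵀ * A (φ k) + A (φ k) * X) atTop (𝓝 (Xᵀ * P + P * X)) :=
      ((by fun_prop : Continuous fun Z : Matrix m m ℝ ↦ Xᵀ * Z + Z * X).tendsto P).comp hlim
    have h2 : Tendsto (fun k : ℕ ↦ Xᵀ * A k + A k * X) atTop (𝓝 0) := by
      simp only [hAX]
      refine squeeze_zero_norm (a := fun k : ℕ ↦ ((k : ℝ) + 1)⁻¹ * (M + M)) (fun k ↦ ?_) ?_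
      · rw [norm_smul, norm_inv, Real.norm_of_nonneg (by positivity : (0 : ℝ) ≤ k + 1)]
        gcongr
        exact (norm_sub_le _ _).trans (add_le_add (hM _) (hM _))
      · simpa using (tendsto_one_div_add_atTop_nhds_zero_nat (𝕜 := ℝ)).mul_const (M + M)
    exact tendsto_nhds_unique h1 (h2.comp hφ.tendsto_atTop)

end Average

theorem Omega_transpose (n : ℕ) : (Omega n)ᵀ = -Omega n := by
  simp [Omega, fromBlocks_transpose, fromBlocks_neg]

theorem Omega_mul_Omega (n : ℕ) : Omega n * Omega n = -1 := by
  simp [Omega, fromBlocks_multiply, ← fromBlocks_one, fromBlocks_neg]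

theorem isUnit_Omega (n : ℕ) : IsUnit (Omega n) :=
  ⟨⟨Omega n, -Omega n, by simp [Omega_mul_Omega], by simp [Omega_mul_Omega]⟩, rfl⟩

theorem Omega_inv (n : ℕ) : (Omega n)⁻¹ = -Omega n :=
  inv_eq_left_inv (by simp [Omega_mul_Omega])

theorem isUnit_of_mem_Sp {n : ℕ} {S : Matrix (Fin n ⊕ Fin n) (Fin n ⊕ Fin n) ℝ} (hS : S ∈ Sp n) :
    IsUnit S := by
  have h : -Omega n * Sᵀ * Omega n * S = 1 := by
    rw [mul_assoc, mul_assoc, ← mul_assoc Sᵀ, show Sᵀ * Omega n * S = Omega n from hS]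
    simp [Omega_mul_Omega]
  exact IsUnit.of_mul_eq_one_right _ h

section
open NormedSpace
open scoped Matrix.Norms.Operator

theorem exp_mem_Sp {n : ℕ} {X : Matrix (Fin n ⊕ Fin n) (Fin n ⊕ Fin n) ℝ} (hX : X ∈ sp n) :
    exp X ∈ Sp n := by
  have h1 : Omega n * exp X * (Omega n)⁻¹ = exp (-Xᵀ) := by
    have h2 : Omega n * X = -(Xᵀ * Omega n) := by
      rw [eq_neg_iff_add_eq_zero, add_comm]; exact hX
    rw [← Matrix.exp_conj _ _ (isUnit_Omega n), h2, Omega_inv]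
    simp [mul_assoc, Omega_mul_Omega]
  have hd : IsUnit (exp X).det := (isUnit_iff_isUnit_det _).1 (Matrix.isUnit_exp X)
  have hd' : IsUnit (Omega n).det := (isUnit_iff_isUnit_det _).1 (isUnit_Omega n)
  have h3 : Omega n * exp X = ((exp X)ᵀ)⁻¹ * Omega n := by
    rw [← Matrix.exp_transpose, ← Matrix.exp_neg, ← h1, mul_assoc _ (Omega n)⁻¹,
      nonsing_inv_mul _ hd', mul_one]
  change (exp X)ᵀ * Omega n * exp X = Omega n
  rw [mul_assoc, h3, ← mul_assoc, mul_nonsing_inv _ (by rwa [det_transpose]), one_mul]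

theorem exp_smul_mul_self {m : Type*} [Fintype m] [DecidableEq m] (X : Matrix m m ℝ) (t : ℝ) :
    exp (t • X) * X = X * exp (t • X) :=
  ((Commute.refl X).smul_left t).exp_left.eq
end

theorem isCompact_setOf_transpose_mul_self_eq_one (m : Type*) [Fintype m] [DecidableEq m] :
    IsCompact {T : Matrix m m ℝ | Tᵀ * T = 1} := by
  have hK : IsCompact (Set.univ.pi fun _ : m ↦ Set.univ.pi fun _ : m ↦ Set.Icc (-1 : ℝ) 1) :=
    isCompact_univ_pi fun _ ↦ isCompact_univ_pi fun _ ↦ isCompact_Icc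
  refine hK.of_isClosed_subset (isClosed_eq ?_ continuous_const)
    fun (T : Matrix m m ℝ) hT i _ j _ ↦ ?_
  · exact (Continuous.matrix_transpose continuous_id).matrix_mul continuous_id
  · have hT' : T ∈ unitaryGroup m ℝ := mem_unitaryGroup_iff'.2 (by
      rw [star_eq_conjTranspose, conjTranspose_eq_transpose_of_trivial]
      exact hT)
    exact abs_le.1 (entry_norm_bound_of_unitary hT' i j)

open Filter Topology in
/-- If `Y` commutes with the complex structure `W`, then for small `ε ≠ 0` everything that
commutes with `Y + ε W` commutes with `W`. -/
theorem eventually_commute_of_commute_add_smul {m : Type*} [Fintype m] [DecidableEq m]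
    {W Y : Matrix m m ℝ} (hW : W * W = -1) (hY : Y * W = W * Y) :
    ∀ᶠ ε : ℝ in 𝓝[≠] 0, ∀ T : Matrix m m ℝ,
      T * (Y + ε • W) = (Y + ε • W) * T → T * W = W * T := by
  let Φ : Module.End ℝ (Matrix m m ℝ) :=
    LinearMap.mulLeft ℝ W ∘ₗ (LinearMap.mulLeft ℝ Y - LinearMap.mulRight ℝ Y)
  have hΦ (D) : Φ D = W * (Y * D - D * Y) := rfl
  have hfin : {ε : ℝ | Φ.HasEigenvalue (2 * ε)}.Finite :=
    (Module.End.finite_hasEigenvalue Φ).preimage (mul_right_injective₀ two_ne_zero).injOn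
  have hev : ∀ᶠ ε : ℝ in 𝓝[≠] 0, ¬ Φ.HasEigenvalue (2 * ε) := by
    filter_upwards [nhdsWithin_le_nhds
      ((hfin.sdiff (t := {0})).isClosed.isOpen_compl.mem_nhds (by simp)),
      self_mem_nhdsWithin] with ε h1 h2 h3
    exact h1 ⟨h3, h2⟩
  filter_upwards [hev] with ε hε T hT
  obtain ⟨D, hD⟩ : ∃ D, D = T + W * T * W := ⟨_, rfl⟩
  have hDW : D * W = -(W * D) := by
    calc D * W = T * W + W * T * (W * W) := by rw [hD]; noncomm_ring
      _ = -(W * T + (W * W) * T * W) := by rw [hW]; noncomm_ring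
      _ = _ := by rw [hD]; noncomm_ring
  have hDY : D * (Y + ε • W) = (Y + ε • W) * D := by
    have hZ : W * (Y + ε • W) = (Y + ε • W) * W := by simp [mul_add, add_mul, hY]
    generalize Y + ε • W = Z at hT hZ
    calc D * Z = T * Z + W * T * (W * Z) := by rw [hD]; noncomm_ring
      _ = T * Z + W * (T * Z) * W := by rw [hZ]; noncomm_ring
      _ = Z * T + (W * Z) * T * W := by rw [hT]; noncomm_ring
      _ = Z * D := by rw [hZ, hD]; noncomm_ring
  have hD0 : D = 0 := by
    by_contra h0
    refine hε (Module.End.hasEigenvalue_of_hasEigenvector (x := D)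
      ⟨Module.End.mem_eigenspace_iff.2 ?_, h0⟩)
    rw [mul_add, add_mul, mul_smul_comm, smul_mul_assoc, hDW] at hDY
    have : Y * D - D * Y = -((2 * ε) • (W * D)) := by
      rw [smul_neg, ← sub_eq_iff_eq_add] at hDY
      rw [← hDY]
      module
    rw [hΦ, this, mul_neg, mul_smul_comm, ← mul_assoc, hW]
    simp
  calc T * W = -(W * W) * T * W := by rw [hW]; simp
    _ = W * T - W * D := by rw [hD]; noncomm_ring
    _ = W * T := by rw [hD0]; simp

theorem stable_of_isCompact_centralizer {n : ℕ} {X : Matrix (Fin n ⊕ Fin n) (Fin n ⊕ Fin n) ℝ}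
    (hX : X ∈ sp n) (hC : IsCompact {S ∈ Sp n | S * X = X * S}) :
    ∃ S ∈ Sp n, (S⁻¹ * X * S) * Omega n = Omega n * (S⁻¹ * X * S) := by
  have hexp (t : ℝ) : NormedSpace.exp (t • X) ∈ {S ∈ Sp n | S * X = X * S} := by
    refine ⟨exp_mem_Sp ?_, exp_smul_mul_self X t⟩
    have hX' : Xᵀ * Omega n + Omega n * X = 0 := hX
    change (t • X)ᵀ * Omega n + Omega n * (t • X) = 0
    rw [transpose_smul, smul_mul_assoc, mul_smul_comm, ← smul_add, hX', smul_zero]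
  obtain ⟨P, hP, hPX⟩ :=
    exists_invariant_form_of_exp_mem_compact hC (fun S hS ↦ isUnit_of_mem_Sp hS.1) hexp
  exact exists_conj_commute_of_invariant_form (Omega_transpose n) (Omega_mul_Omega n) hP hPX hX

/-- A Lie algebra element conjugate under `S` to one for which everything commuting with it commutes
with `Ω` is strongly stable. -/
theorem isCompact_centralizer {n : ℕ} {S X Y : Matrix (Fin n ⊕ Fin n) (Fin n ⊕ Fin n) ℝ}
    (hS : S ∈ Sp n) (hXY : X * S = S * Y)
    (hY : ∀ T : Matrix (Fin n ⊕ Fin n) (Fin n ⊕ Fin n) ℝ,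
      T * Y = Y * T → T * Omega n = Omega n * T) :
    IsCompact {T ∈ Sp n | T * X = X * T} := by
  have hSd : IsUnit S.det := (isUnit_iff_isUnit_det _).1 (isUnit_of_mem_Sp hS)
  have hS1 : S * S⁻¹ = 1 := mul_nonsing_inv _ hSd
  have hS2 : S⁻¹ * S = 1 := nonsing_inv_mul _ hSd
  have hSW : Sᵀ * Omega n * S = Omega n := hS
  have hSiW : S⁻¹ᵀ * Omega n * S⁻¹ = Omega n := by
    calc S⁻¹ᵀ * Omega n * S⁻¹ = S⁻¹ᵀ * (Sᵀ * Omega n * S) * S⁻¹ := by rw [hSW]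
      _ = (S * S⁻¹)ᵀ * Omega n * (S * S⁻¹) := by rw [transpose_mul]; noncomm_ring
      _ = Omega n := by rw [hS1]; simp
  have hcl : IsClosed {T ∈ Sp n | T * X = X * T} :=
    (isClosed_eq (by fun_prop : Continuous fun T : Matrix (Fin n ⊕ Fin n) (Fin n ⊕ Fin n) ℝ ↦
      Tᵀ * Omega n * T) continuous_const).inter (isClosed_eq (by fun_prop) (by fun_prop))
  refine ((isCompact_setOf_transpose_mul_self_eq_one (Fin n ⊕ Fin n)).image
    (by fun_prop : Continuous fun T ↦ S * T * S⁻¹)).of_isClosed_subset hcl ?_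
  rintro T ⟨hT, hTX⟩
  have hTW : Tᵀ * Omega n * T = Omega n := hT
  refine ⟨S⁻¹ * T * S, ?_, ?_⟩
  · have hYX : Y = S⁻¹ * X * S := by rw [mul_assoc, hXY, ← mul_assoc, hS2, one_mul]
    have hcomm : (S⁻¹ * T * S) * Omega n = Omega n * (S⁻¹ * T * S) := by
      refine hY _ ?_
      calc S⁻¹ * T * S * Y = S⁻¹ * T * (S * S⁻¹) * X * S := by rw [hYX]; noncomm_ring
        _ = S⁻¹ * (T * X) * S := by rw [hS1]; noncomm_ring
        _ = S⁻¹ * X * 1 * T * S := by rw [hTX]; noncomm_ring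
        _ = Y * (S⁻¹ * T * S) := by rw [← hS1, hYX]; noncomm_ring
    have hsymp : (S⁻¹ * T * S)ᵀ * Omega n * (S⁻¹ * T * S) = Omega n := by
      calc _ = Sᵀ * (Tᵀ * (S⁻¹ᵀ * Omega n * S⁻¹) * T) * S := by
            rw [transpose_mul, transpose_mul]; noncomm_ring
        _ = Omega n := by rw [hSiW, hTW, hSW]
    generalize S⁻¹ * T * S = U at hcomm hsymp
    change Uᵀ * U = 1
    calc Uᵀ * U = -(Uᵀ * (U * Omega n) * Omega n) := by
          rw [mul_assoc, mul_assoc, Omega_mul_Omega]; simp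
      _ = -(Uᵀ * Omega n * U * Omega n) := by rw [hcomm]; noncomm_ring
      _ = 1 := by rw [hsymp, Omega_mul_Omega, neg_neg]
  · calc S * (S⁻¹ * T * S) * S⁻¹ = (S * S⁻¹) * T * (S * S⁻¹) := by noncomm_ring
      _ = T := by rw [hS1]; simp

theorem add_smul_mem_sp {n : ℕ} {X : Matrix (Fin n ⊕ Fin n) (Fin n ⊕ Fin n) ℝ} (hX : X ∈ sp n)
    (S : Matrix (Fin n ⊕ Fin n) (Fin n ⊕ Fin n) ℝ) (ε : ℝ) :
    X + ε • (S * Sᵀ * Omega n) ∈ sp n := by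
  have hX' : Xᵀ * Omega n + Omega n * X = 0 := hX
  change (X + ε • (S * Sᵀ * Omega n))ᵀ * Omega n + Omega n * (X + ε • (S * Sᵀ * Omega n)) = 0
  calc _ = (Xᵀ * Omega n + Omega n * X) +
        ε • ((S * Sᵀ * Omega n)ᵀ * Omega n + Omega n * (S * Sᵀ * Omega n)) := by
        rw [transpose_add, transpose_smul, add_mul, mul_add, smul_mul_assoc, mul_smul_comm,
          smul_add]
        abel
    _ = 0 := by
        rw [hX', transpose_mul, transpose_mul, transpose_transpose, Omega_transpose]
        simp [mul_assoc]

/-- Inside `sp(2n,ℝ)`, the closure of the set `𝒟` of strongly stable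
elements equals the closure of the set of stable elements (those conjugate under
`Sp(2n,ℝ)` into the unitary subalgebra). -/
theorem closure_stronglyStable_eq_closure_stable (n : ℕ) :
    closure {X : (sp n) | IsCompact {S ∈ Sp n |
        S * (X : Matrix (Fin n ⊕ Fin n) (Fin n ⊕ Fin n) ℝ)
          = (X : Matrix (Fin n ⊕ Fin n) (Fin n ⊕ Fin n) ℝ) * S}} =
      closure {X : (sp n) | ∃ S ∈ Sp n,
        (S⁻¹ * (X : Matrix (Fin n ⊕ Fin n) (Fin n ⊕ Fin n) ℝ) * S) * Omega n
          = Omega n * (S⁻¹ * (X : Matrix (Fin n ⊕ Fin n) (Fin n ⊕ Fin n) ℝ) * S)} := by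
  refine subset_antisymm (closure_mono fun X hX ↦ stable_of_isCompact_centralizer X.2 hX)
    (closure_minimal ?_ isClosed_closure)
  rintro X ⟨S, hS, hY⟩
  have hSd : IsUnit S.det := (isUnit_iff_isUnit_det _).1 (isUnit_of_mem_Sp hS)
  have hSW : Sᵀ * Omega n * S = Omega n := hS
  let f : ℝ → sp n := fun ε ↦ ⟨X + ε • (S * Sᵀ * Omega n), add_smul_mem_sp X.2 S ε⟩
  have hf : Continuous f := by
    refine Continuous.subtype_mk ?_ _
    fun_prop
  have hf0 : f 0 = X := Subtype.ext (by simp [f])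
  have hlim : Filter.Tendsto f (nhdsWithin 0 {0}ᶜ) (nhds X) := by
    simpa only [hf0] using (hf.tendsto 0).mono_left nhdsWithin_le_nhds
  refine mem_closure_of_tendsto hlim ?_
  filter_upwards [eventually_commute_of_commute_add_smul (Omega_mul_Omega n) hY] with ε hε
  refine isCompact_centralizer hS ?_ hε
  calc (X + ε • (S * Sᵀ * Omega n)) * S = X * S + ε • (S * (Sᵀ * Omega n * S)) := by
        rw [add_mul, smul_mul_assoc]; simp only [mul_assoc]
    _ = S * (S⁻¹ * X * S + ε • Omega n) := by
        rw [hSW, mul_add, mul_smul_comm, ← mul_assoc, ← mul_assoc, mul_nonsing_inv _ hSd, one_mul]
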